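/- Fix a reward function R₀ and ε>0, and let Π^ε = {π stationary : J_{R₀}(π) ≥ max_{π'} J_{R₀}(π') − ε} be the set of ε-suboptimal policies. Then any pair of reward functions R₁, R₂ that are unhackable on Π^ε and both non-trivial on Π^ε are equivalent on Π^ε. -/

import Mathlib

open scoped BigOperators

/-- A rewardless MDP with finite state and action spaces: transition kernel `T`,
initial distribution `I`, and discount factor `γ ∈ (0,1)`. -/
structure MDPnr (S A : Type) [Fintype S] [Fintype A] where
  T : S → A → S → ℝ
  T_nonneg : ∀ s a s', 0 ≤ T s a s'
  T_sum : ∀ s a, ∑ s', T s a s' = 1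
  I : S → ℝ
  I_nonneg : ∀ s, 0 ≤ I s
  I_sum : ∑ s, I s = 1
  γ : ℝ
  γ_pos : 0 < γ
  γ_lt_one : γ < 1

variable {S A : Type} [Fintype S] [Fintype A]

/-- A stationary policy: a distribution over actions in each state. -/
def IsPolicy (π : S → A → ℝ) : Prop :=
  (∀ s a, 0 ≤ π s a) ∧ ∀ s, ∑ a, π s a = 1

/-- The set of all stationary policies. -/
def allPolicies (S A : Type) [Fintype S] [Fintype A] : Set (S → A → ℝ) :=
  {π | IsPolicy π}

/-- The distribution over states at time `t` induced by policy `π`. -/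
def stateDist (M : MDPnr S A) (π : S → A → ℝ) : ℕ → S → ℝ
  | 0 => M.I
  | t + 1 => fun s' => ∑ s, ∑ a, stateDist M π t s * π s a * M.T s a s'

/-- Discounted state-action visit counts `F(π)(s,a) = ∑ₜ γᵗ P(Sₜ = s, Aₜ = a)`. -/
noncomputable def visit (M : MDPnr S A) (π : S → A → ℝ) : S → A → ℝ :=
  fun s a => ∑' t : ℕ, M.γ ^ t * stateDist M π t s * π s a

/-- The visit counts viewed as a vector in `ℝ^{S×A}`. -/
noncomputable def Fvec (M : MDPnr S A) (π : S → A → ℝ) : S × A → ℝ :=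
  fun p => visit M π p.1 p.2

/-- The value `J_R(π) = ∑_{s,a} R(s,a) F(π)(s,a)` of a policy `π` under reward `R`. -/
noncomputable def Jval (M : MDPnr S A) (R : S → A → ℝ) (π : S → A → ℝ) : ℝ :=
  ∑ s, ∑ a, R s a * visit M π s a

/-- `R₁, R₂` are unhackable on policy set `P` if no pair of policies is ordered
oppositely by the two reward functions. -/
def Unhackable (M : MDPnr S A) (P : Set (S → A → ℝ)) (R₁ R₂ : S → A → ℝ) : Prop :=
  ¬ ∃ π ∈ P, ∃ π' ∈ P, Jval M R₁ π < Jval M R₁ π' ∧ Jval M R₂ π > Jval M R₂ π'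

/-- `R₁, R₂` are equivalent on `P` if they induce the same preference ordering. -/
def EquivalentOn (M : MDPnr S A) (P : Set (S → A → ℝ)) (R₁ R₂ : S → A → ℝ) : Prop :=
  ∀ π ∈ P, ∀ π' ∈ P, (Jval M R₁ π ≤ Jval M R₁ π' ↔ Jval M R₂ π ≤ Jval M R₂ π')

/-- `R` is trivial on `P` if its value function is constant on `P`. -/
def TrivialOn (M : MDPnr S A) (P : Set (S → A → ℝ)) (R : S → A → ℝ) : Prop :=
  ∀ π ∈ P, ∀ π' ∈ P, Jval M R π = Jval M R π'

/-- The embedding `G(π)(s,a) = π(a|s)` of policies into `ℝ^{S×A}`. -/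
def Gmap (π : S → A → ℝ) : S × A → ℝ := fun p => π p.1 p.2

/-- A set of stationary policies is open if its image under `G` is open in the
smallest affine subspace of `ℝ^{S×A}` containing the `G`-image of all policies. -/
def OpenPolicySet (Pd : Set (S → A → ℝ)) : Prop :=
  Pd ⊆ allPolicies S A ∧
  IsOpen {x : (affineSpan ℝ (Gmap '' allPolicies S A) : Set (S × A → ℝ)) |
    (x : S × A → ℝ) ∈ Gmap '' Pd}

/-- Every state is reachable (with positive probability) under some policy. -/
def AllReachable (M : MDPnr S A) : Prop :=
  ∀ s : S, ∃ π : S → A → ℝ, IsPolicy π ∧ ∃ t : ℕ, 0 < stateDist M π t s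

/-- `R₂` is a simplification of `R₁` relative to `P`. -/
def Simplification (M : MDPnr S A) (P : Set (S → A → ℝ)) (R₁ R₂ : S → A → ℝ) : Prop :=
  (∀ π ∈ P, ∀ π' ∈ P,
    (Jval M R₁ π < Jval M R₁ π' → Jval M R₂ π ≤ Jval M R₂ π') ∧
    (Jval M R₁ π = Jval M R₁ π' → Jval M R₂ π = Jval M R₂ π')) ∧
  ∃ π ∈ P, ∃ π' ∈ P, Jval M R₂ π = Jval M R₂ π' ∧ Jval M R₁ π ≠ Jval M R₁ π'

/-- The set of ε-suboptimal stationary policies with respect to `R₀`: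
those `π` with `J(π) ≥ J(π') − ε` for every policy `π'` (i.e. `J(π) ≥ J(π*) − ε`). -/
def SubOptSet (M : MDPnr S A) (R₀ : S → A → ℝ) (ε : ℝ) : Set (S → A → ℝ) :=
  {π | IsPolicy π ∧ ∀ π' : S → A → ℝ, IsPolicy π' → Jval M R₀ π' - ε ≤ Jval M R₀ π}

/-- The discounted state visit counts `∑ₜ γᵗ P(Sₜ = s)`. -/
noncomputable def stateVisit (M : MDPnr S A) (π : S → A → ℝ) (s : S) : ℝ :=
  ∑' t : ℕ, M.γ ^ t * stateDist M π t s

theorem stateDist_nonneg (M : MDPnr S A) {π : S → A → ℝ} (hπ : IsPolicy π) (t : ℕ) (s : S) :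
    0 ≤ stateDist M π t s := by
  induction t generalizing s with
  | zero => exact M.I_nonneg s
  | succ t ih =>
    exact Finset.sum_nonneg fun s' _ => Finset.sum_nonneg fun a _ =>
      mul_nonneg (mul_nonneg (ih s') (hπ.1 s' a)) (M.T_nonneg s' a s)

theorem sum_mul_policy_mul_T (M : MDPnr S A) {π : S → A → ℝ} (hπ : IsPolicy π) (d : S → ℝ) :
    ∑ s', ∑ s, ∑ a, d s * π s a * M.T s a s' = ∑ s, d s := by
  rw [Finset.sum_comm]
  refine Finset.sum_congr rfl fun s _ => ?_
  rw [Finset.sum_comm]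
  simp only [← Finset.mul_sum, M.T_sum, mul_one, hπ.2]

theorem stateDist_sum (M : MDPnr S A) {π : S → A → ℝ} (hπ : IsPolicy π) (t : ℕ) :
    ∑ s, stateDist M π t s = 1 := by
  induction t with
  | zero => exact M.I_sum
  | succ t ih => exact (sum_mul_policy_mul_T M hπ _).trans ih

theorem stateDist_le_one (M : MDPnr S A) {π : S → A → ℝ} (hπ : IsPolicy π) (t : ℕ) (s : S) :
    stateDist M π t s ≤ 1 :=
  stateDist_sum M hπ t ▸
    Finset.single_le_sum (fun s _ => stateDist_nonneg M hπ t s) (Finset.mem_univ s)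

theorem summable_stateDist (M : MDPnr S A) {π : S → A → ℝ} (hπ : IsPolicy π) (s : S) :
    Summable fun t : ℕ => M.γ ^ t * stateDist M π t s :=
  Summable.of_nonneg_of_le
    (fun t => mul_nonneg (pow_nonneg M.γ_pos.le t) (stateDist_nonneg M hπ t s))
    (fun t => mul_le_of_le_one_right (pow_nonneg M.γ_pos.le t) (stateDist_le_one M hπ t s))
    (summable_geometric_of_lt_one M.γ_pos.le M.γ_lt_one)

theorem stateVisit_nonneg (M : MDPnr S A) {π : S → A → ℝ} (hπ : IsPolicy π) (s : S) :
    0 ≤ stateVisit M π s :=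
  tsum_nonneg fun t => mul_nonneg (pow_nonneg M.γ_pos.le t) (stateDist_nonneg M hπ t s)

theorem visit_eq (M : MDPnr S A) (π : S → A → ℝ) (s : S) (a : A) :
    visit M π s a = stateVisit M π s * π s a :=
  tsum_mul_right

/-- The Bellman flow equation for the state visit counts. -/
theorem stateVisit_flow (M : MDPnr S A) {π : S → A → ℝ} (hπ : IsPolicy π) (s' : S) :
    stateVisit M π s' =
      M.I s' + M.γ * ∑ s, ∑ a, stateVisit M π s * π s a * M.T s a s' := by
  have h : HasSum (fun t : ℕ => M.γ ^ (t + 1) * stateDist M π (t + 1) s')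
      (M.γ * ∑ s, ∑ a, stateVisit M π s * π s a * M.T s a s') := by
    have h' := (hasSum_sum fun s (_ : s ∈ Finset.univ) =>
      hasSum_sum fun a (_ : a ∈ Finset.univ) =>
        (((summable_stateDist M hπ s).hasSum.mul_right (π s a)).mul_right
          (M.T s a s'))).mul_left M.γ
    refine (congrArg (HasSum · _) (funext fun t => ?_)).mpr h'
    simp only [stateDist, Finset.mul_sum]
    refine Finset.sum_congr rfl fun s _ => Finset.sum_congr rfl fun a _ => ?_
    ring
  rw [stateVisit, (summable_stateDist M hπ s').tsum_eq_zero_add, h.tsum_eq]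
  simp [stateDist]

/-- The Bellman flow equation has a unique solution. -/
theorem eq_stateVisit_of_flow (M : MDPnr S A) {π : S → A → ℝ} (hπ : IsPolicy π) {d : S → ℝ}
    (hd : ∀ s', d s' = M.I s' + M.γ * ∑ s, ∑ a, d s * π s a * M.T s a s') (s : S) :
    d s = stateVisit M π s := by
  set e : S → ℝ := fun s => d s - stateVisit M π s with he
  have hflow (s' : S) : e s' = M.γ * ∑ s, ∑ a, e s * π s a * M.T s a s' := by
    simp only [he, sub_mul, Finset.sum_sub_distrib, mul_sub]
    linarith [hd s', stateVisit_flow M hπ s']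
  have hle : ∑ s, |e s| ≤ M.γ * ∑ s, |e s| := by
    conv_rhs => rw [← sum_mul_policy_mul_T M hπ fun s => |e s|, Finset.mul_sum]
    refine Finset.sum_le_sum fun s' _ => ?_
    rw [hflow s', abs_mul, abs_of_pos M.γ_pos]
    refine mul_le_mul_of_nonneg_left ?_ M.γ_pos.le
    refine (Finset.abs_sum_le_sum_abs _ _).trans (Finset.sum_le_sum fun s _ => ?_)
    refine (Finset.abs_sum_le_sum_abs _ _).trans (Finset.sum_le_sum fun a _ => ?_)
    rw [abs_mul, abs_mul, abs_of_nonneg (hπ.1 s a), abs_of_nonneg (M.T_nonneg s a s')]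
  have hnn : 0 ≤ ∑ s, |e s| := Finset.sum_nonneg fun s _ => abs_nonneg _
  have h0 : ∑ s, |e s| = 0 := by nlinarith [M.γ_lt_one]
  have hs := (Finset.sum_eq_zero_iff_of_nonneg fun s _ => abs_nonneg (e s)).1 h0 s
    (Finset.mem_univ s)
  exact sub_eq_zero.1 (abs_eq_zero.1 hs)

/-- The set of visit counts of stationary policies is convex. -/
theorem exists_policy_visit_eq (M : MDPnr S A) {π π' : S → A → ℝ} (hπ : IsPolicy π)
    (hπ' : IsPolicy π') {u v : ℝ} (hu : 0 ≤ u) (hv : 0 ≤ v) (huv : u + v = 1) :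
    ∃ w, IsPolicy w ∧ ∀ s a, visit M w s a = u * visit M π s a + v * visit M π' s a := by
  classical
  set m : S → ℝ := fun s => u * stateVisit M π s + v * stateVisit M π' s with hm
  set x : S → A → ℝ := fun s a => u * visit M π s a + v * visit M π' s a with hx
  set w : S → A → ℝ := fun s a => if m s = 0 then π s a else x s a / m s with hw
  have hd (s : S) : 0 ≤ u * stateVisit M π s := mul_nonneg hu (stateVisit_nonneg M hπ s)
  have hd' (s : S) : 0 ≤ v * stateVisit M π' s := mul_nonneg hv (stateVisit_nonneg M hπ' s)
  have hx_eq (s : S) (a : A) :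
      x s a = u * stateVisit M π s * π s a + v * stateVisit M π' s * π' s a := by
    simp only [hx, visit_eq, mul_assoc]
  have hmw (s : S) (a : A) : m s * w s a = x s a := by
    by_cases h : m s = 0
    · obtain ⟨h₁, h₂⟩ := (add_eq_zero_iff_of_nonneg (hd s) (hd' s)).1 h
      rw [h, zero_mul, hx_eq, h₁, h₂, zero_mul, zero_mul, add_zero]
    · simp only [hw, if_neg h, mul_div_cancel₀ _ h]
  have hwp : IsPolicy w := by
    refine ⟨fun s a => ?_, fun s => ?_⟩
    · by_cases h : m s = 0
      · simpa only [hw, if_pos h] using hπ.1 s a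
      · simp only [hw, if_neg h]
        refine div_nonneg ?_ (add_nonneg (hd s) (hd' s))
        rw [hx_eq]
        exact add_nonneg (mul_nonneg (hd s) (hπ.1 s a)) (mul_nonneg (hd' s) (hπ'.1 s a))
    · by_cases h : m s = 0
      · simpa only [hw, if_pos h] using hπ.2 s
      · simp only [hw, if_neg h, ← Finset.sum_div, hx_eq, Finset.sum_add_distrib,
          ← Finset.mul_sum, hπ.2, hπ'.2, mul_one]
        exact div_self h
  have hmv : ∀ s, m s = stateVisit M w s := by
    refine eq_stateVisit_of_flow M hwp fun s' => ?_
    simp only [hmw, hx_eq, add_mul, Finset.sum_add_distrib]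
    simp only [mul_assoc, ← Finset.mul_sum]
    have e₁ := stateVisit_flow M hπ s'
    have e₂ := stateVisit_flow M hπ' s'
    simp only [mul_assoc, ← Finset.mul_sum] at e₁ e₂
    simp only [hm]
    linear_combination u * e₁ + v * e₂ + M.I s' * huv
  exact ⟨w, hwp, fun s a => by rw [visit_eq, ← hmv, hmw]⟩

/-- Convex combinations of values are realised within the set of `ε`-suboptimal policies. -/
theorem exists_mem_subOptSet_Jval_eq (M : MDPnr S A) {R₀ : S → A → ℝ} {ε : ℝ}
    {π π' : S → A → ℝ} (hπ : π ∈ SubOptSet M R₀ ε) (hπ' : π' ∈ SubOptSet M R₀ ε)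
    {u v : ℝ} (hu : 0 ≤ u) (hv : 0 ≤ v) (huv : u + v = 1) :
    ∃ w ∈ SubOptSet M R₀ ε, ∀ R, Jval M R w = u * Jval M R π + v * Jval M R π' := by
  obtain ⟨w, hw, hwv⟩ := exists_policy_visit_eq M hπ.1 hπ'.1 hu hv huv
  have hJ (R : S → A → ℝ) : Jval M R w = u * Jval M R π + v * Jval M R π' := by
    simp only [Jval, hwv, Finset.mul_sum, ← Finset.sum_add_distrib]
    refine Finset.sum_congr rfl fun s _ => Finset.sum_congr rfl fun a _ => ?_
    ring
  refine ⟨w, ⟨hw, fun ρ hρ => ?_⟩, hJ⟩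
  rw [hJ]
  calc Jval M R₀ ρ - ε = u * (Jval M R₀ ρ - ε) + v * (Jval M R₀ ρ - ε) := by
        rw [← add_mul, huv, one_mul]
    _ ≤ u * Jval M R₀ π + v * Jval M R₀ π' :=
        add_le_add (mul_le_mul_of_nonneg_left (hπ.2 ρ hρ) hu)
          (mul_le_mul_of_nonneg_left (hπ'.2 ρ hρ) hv)

theorem exists_convex_weight_lt {a b : ℝ} (c : ℝ) (hab : a < b) :
    ∃ t : ℝ, 0 < t ∧ t < 1 ∧ (1 - t) * a + t * c < b := by
  have hlim : Filter.Tendsto (fun t : ℝ => (1 - t) * a + t * c) (nhdsWithin 0 (Set.Ioi 0))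
      (nhds a) := by
    have : Continuous fun t : ℝ => (1 - t) * a + t * c := by fun_prop
    simpa using (this.tendsto 0).mono_left nhdsWithin_le_nhds
  obtain ⟨t, ht, ht'⟩ := ((hlim.eventually_lt_const hab).and
    (Ioo_mem_nhdsGT (zero_lt_one (α := ℝ)))).exists
  exact ⟨t, ht'.1, ht'.2, ht⟩

/-- Of two unhackable rewards, a non-trivial one determines the weak order of the other. -/
theorem Jval_le_of_unhackable_of_not_trivial (M : MDPnr S A) {R₀ : S → A → ℝ} {ε : ℝ}
    {R₁ R₂ : S → A → ℝ} (hunh : Unhackable M (SubOptSet M R₀ ε) R₁ R₂)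
    (h1 : ¬ TrivialOn M (SubOptSet M R₀ ε) R₁) {π π' : S → A → ℝ}
    (hπ : π ∈ SubOptSet M R₀ ε) (hπ' : π' ∈ SubOptSet M R₀ ε)
    (hle : Jval M R₁ π ≤ Jval M R₁ π') : Jval M R₂ π ≤ Jval M R₂ π' := by
  by_contra! hlt
  have heq : Jval M R₁ π = Jval M R₁ π' :=
    hle.eq_of_not_lt fun h => hunh ⟨π, hπ, π', hπ', h, hlt⟩
  obtain ⟨z, hz, hne⟩ : ∃ z ∈ SubOptSet M R₀ ε, Jval M R₁ z ≠ Jval M R₁ π := by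
    by_contra! h
    exact h1 fun ρ hρ ρ' hρ' => (h ρ hρ).trans (h ρ' hρ').symm
  rcases hne.lt_or_gt with hz1 | hz1
  · obtain ⟨t, h0, ht, hval⟩ := exists_convex_weight_lt (-Jval M R₂ z) (neg_lt_neg hlt)
    obtain ⟨w, hw, hJ⟩ := exists_mem_subOptSet_Jval_eq M hπ hz (sub_nonneg.2 ht.le) h0.le
      (sub_add_cancel 1 t)
    refine hunh ⟨w, hw, π', hπ', ?_, ?_⟩
    · rw [hJ]; nlinarith
    · rw [hJ]; linarith
  · obtain ⟨t, h0, ht, hval⟩ := exists_convex_weight_lt (Jval M R₂ z) hlt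
    obtain ⟨w, hw, hJ⟩ := exists_mem_subOptSet_Jval_eq M hπ' hz (sub_nonneg.2 ht.le) h0.le
      (sub_add_cancel 1 t)
    refine hunh ⟨π, hπ, w, hw, ?_, ?_⟩
    · rw [hJ]; nlinarith
    · rw [hJ]; linarith

theorem Unhackable.symm {M : MDPnr S A} {P : Set (S → A → ℝ)} {R₁ R₂ : S → A → ℝ}
    (h : Unhackable M P R₁ R₂) : Unhackable M P R₂ R₁ :=
  fun ⟨π, hπ, π', hπ', h₁, h₂⟩ => h ⟨π', hπ', π, hπ, h₂, h₁⟩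

/-- On the set of all ε-suboptimal policies (ε > 0), any pair of
unhackable, non-trivial reward functions are equivalent. -/
theorem unhackable_nontrivial_equivalent_on_subopt
    (M : MDPnr S A) (hA : 1 < Fintype.card A) (hreach : AllReachable M)
    (R₀ : S → A → ℝ) (ε : ℝ) (hε : 0 < ε)
    (R₁ R₂ : S → A → ℝ)
    (hunh : Unhackable M (SubOptSet M R₀ ε) R₁ R₂)
    (h1 : ¬ TrivialOn M (SubOptSet M R₀ ε) R₁)
    (h2 : ¬ TrivialOn M (SubOptSet M R₀ ε) R₂) :
    EquivalentOn M (SubOptSet M R₀ ε) R₁ R₂ := by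
  exact fun π hπ π' hπ' =>
    ⟨Jval_le_of_unhackable_of_not_trivial M hunh h1 hπ hπ',
      Jval_le_of_unhackable_of_not_trivial M hunh.symm h2 hπ hπ'⟩
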